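/- arXiv:2302.14697 — 2 statements merged into one kernel-verified Lean document; each statement's English description precedes it below -/
import Mathlib

section
/- Let I ⊆ ℂ[x,p] be an ideal and J = ⟨h⟩ a principal ideal with (I : J^∞) ∩ ℂ[p] = {0}. Then there exists a proper algebraic subvariety Δ ⊊ ℂ^k such that for all q ∉ Δ, φ_q(I : J^∞) = φ_q(I) : φ_q(J)^∞. -/
open MvPolynomial

theorem Submodule.mem_of_forall_monomial_mem {σ A : Type*} [CommRing A]
    (W : Submodule A (MvPolynomial σ A)) (r : MvPolynomial σ A)
    (hr : ∀ b ∈ r.support, monomial b (1 : A) ∈ W) : r ∈ W := by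
  rw [r.as_sum]
  refine W.sum_mem fun b hb => ?_
  rw [← mul_one (coeff b r), ← smul_eq_mul, ← smul_monomial]
  exact W.smul_mem _ (hr b hb)

namespace MonomialOrder

variable {σ A : Type*} [CommRing A] (m : MonomialOrder σ)

/-- The exponents that are not the degree of a nonzero element of the ideal `T`. -/
def standardExponents (T : Ideal (MvPolynomial σ A)) : Set (σ →₀ ℕ) :=
  {d | ∀ t ∈ T, t ≠ 0 → m.degree t ≠ d}

theorem eq_zero_of_mem_restrictSupport_standardExponents {T : Ideal (MvPolynomial σ A)}
    {t : MvPolynomial σ A} (ht : t ∈ T) (hs : t ∈ restrictSupport A (m.standardExponents T)) :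
    t = 0 := by
  by_contra h0
  exact (mem_restrictSupport_iff A).1 hs (m.degree_mem_support h0) t ht h0 rfl

/-- The `A`-module of polynomials some `Δ`-power multiple of which is congruent modulo `T` to a
combination of standard monomials. -/
def standardReducible (T : Ideal (MvPolynomial σ A)) (Δ : A) :
    Submodule A (MvPolynomial σ A) where
  carrier := {r | ∃ N : ℕ,
    Δ ^ N • r ∈ T.restrictScalars A ⊔ restrictSupport A (m.standardExponents T)}
  zero_mem' := ⟨0, by simp⟩
  add_mem' := by
    rintro r s ⟨M, hM⟩ ⟨N, hN⟩
    refine ⟨M + N, ?_⟩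
    rw [smul_add]
    refine add_mem ?_ ?_
    · rw [add_comm, pow_add, mul_smul]
      exact Submodule.smul_mem _ _ hM
    · rw [pow_add, mul_smul]
      exact Submodule.smul_mem _ _ hN
  smul_mem' := by
    rintro c r ⟨N, hN⟩
    refine ⟨N, ?_⟩
    rw [smul_comm]
    exact Submodule.smul_mem _ _ hN

theorem mem_standardReducible_of_smul_mem {T : Ideal (MvPolynomial σ A)} {Δ : A}
    {r : MvPolynomial σ A} (h : Δ • r ∈ m.standardReducible T Δ) :
    r ∈ m.standardReducible T Δ := by
  obtain ⟨N, hN⟩ := h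
  exact ⟨N + 1, by rwa [pow_succ, mul_smul]⟩

theorem le_standardReducible (T : Ideal (MvPolynomial σ A)) (Δ : A) :
    T.restrictScalars A ⊔ restrictSupport A (m.standardExponents T) ≤
      m.standardReducible T Δ :=
  fun r hr => ⟨0, by simpa using hr⟩

/-- Over a domain, after inverting a single nonzero element, every polynomial is congruent modulo
`T` to a combination of standard monomials. -/
theorem exists_standardReducible_eq_top [IsDomain A] [Finite σ] (T : Ideal (MvPolynomial σ A)) :
    ∃ Δ : A, Δ ≠ 0 ∧ m.standardReducible T Δ = ⊤ := by
  classical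
  let D : Set (σ →₀ ℕ) := {d | ∃ t ∈ T, t ≠ 0 ∧ m.degree t = d}
  have hfin : {d | Minimal (· ∈ D) d}.Finite :=
    WellQuasiOrderedLE.finite_of_isAntichain (setOfPred_minimal_antichain _)
  have hD : ∀ d : σ →₀ ℕ, ∃ t : MvPolynomial σ A, t ≠ 0 ∧ (d ∈ D → t ∈ T ∧ m.degree t = d) := by
    intro d
    by_cases hd : d ∈ D
    · obtain ⟨t, h1, h2, h3⟩ := hd
      exact ⟨t, h2, fun _ => ⟨h1, h3⟩⟩
    · exact ⟨1, one_ne_zero, fun h => absurd h hd⟩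
  choose t ht0 ht using hD
  let Δ : A := ∏ d ∈ hfin.toFinset, m.leadingCoeff (t d)
  refine ⟨Δ, Finset.prod_ne_zero_iff.2 fun d _ => m.leadingCoeff_ne_zero_iff.2 (ht0 d), ?_⟩
  have hmon : ∀ s : m.syn, monomial (m.toSyn.symm s) (1 : A) ∈ m.standardReducible T Δ := by
    intro s
    induction s using WellFoundedLT.induction with
    | ind s ih =>
    set d := m.toSyn.symm s with hd
    by_cases hdD : d ∈ D
    · obtain ⟨d₀, hle, hmin⟩ := exists_minimal_le_of_wellFoundedLT (· ∈ D) d hdD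
      obtain ⟨htT, htd⟩ := ht d₀ hmin.prop
      obtain ⟨c, hc⟩ : m.leadingCoeff (t d₀) ∣ Δ :=
        Finset.dvd_prod_of_mem _ (hfin.mem_toFinset.2 hmin)
      let g := monomial (d - d₀) (1 : A) * t d₀
      have hgT : g ∈ T := T.mul_mem_left _ htT
      have hdeg : m.degree g = d := by
        rw [m.degree_mul (by simp) (ht0 d₀), degree_monomial, if_neg one_ne_zero, htd,
          tsub_add_cancel_of_le hle]
      have hlc : m.leadingCoeff g = m.leadingCoeff (t d₀) := by simp [g]
      have hlow : g - m.leadingCoeff g • monomial d 1 ∈ m.standardReducible T Δ := by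
        refine Submodule.mem_of_forall_monomial_mem _ _ fun b hb => ?_
        have hbd : b ≠ d := by
          rintro rfl
          simp [leadingCoeff, hdeg] at hb
        have hbg : b ∈ g.support := by
          simpa [coeff_monomial, hbd.symm] using hb
        have hlt : m.toSyn b < s := by
          refine lt_of_le_of_ne ?_ ?_
          · simpa [hdeg, hd] using m.le_degree hbg
          · rintro rfl
            simp [hd] at hbd
        simpa using ih _ hlt
      apply m.mem_standardReducible_of_smul_mem
      have hsmul : Δ • monomial d (1 : A) =
          c • g - c • (g - m.leadingCoeff g • monomial d 1) := by
        rw [hc, ← hlc, smul_sub, sub_sub_cancel, smul_smul, mul_comm]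
      rw [hsmul]
      exact sub_mem (Submodule.smul_mem _ _
        (m.le_standardReducible T Δ (Submodule.mem_sup_left hgT))) (Submodule.smul_mem _ _ hlow)
    · refine m.le_standardReducible T Δ (Submodule.mem_sup_right ?_)
      rw [monomial_mem_restrictSupport]
      exact Or.inl fun u hu hu0 hud => hdD ⟨u, hu, hu0, hud⟩
  exact eq_top_iff.2 fun r _ => Submodule.mem_of_forall_monomial_mem _ r fun b _ => by
    simpa using hmon (m.toSyn b)

/-- If `T` admits reduction to standard monomials up to powers of `Δ`, then `𝔪 A[x] ∩ T` and `𝔪 T`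
agree up to powers of `Δ`. -/
theorem exists_pow_smul_mem_smul_of_mem {T : Ideal (MvPolynomial σ A)} {Δ : A}
    (hΔ : m.standardReducible T Δ = ⊤) (𝔪 : Ideal A) {u : MvPolynomial σ A}
    (hu : u ∈ 𝔪.map (C : A →+* MvPolynomial σ A)) (huT : u ∈ T) :
    ∃ N : ℕ, Δ ^ N • u ∈ 𝔪 • T.restrictScalars A := by
  have key : ∀ r ∈ 𝔪 • (⊤ : Submodule A (MvPolynomial σ A)), ∃ N : ℕ, Δ ^ N • r ∈
      𝔪 • T.restrictScalars A ⊔ 𝔪 • restrictSupport A (m.standardExponents T) := by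
    intro r hr
    induction hr using Submodule.smul_induction_on' with
    | smul a ha r _ =>
      obtain ⟨N, hN⟩ : r ∈ m.standardReducible T Δ := hΔ ▸ Submodule.mem_top
      refine ⟨N, ?_⟩
      rw [smul_comm, ← Submodule.smul_sup]
      exact Submodule.smul_mem_smul ha hN
    | add r _ s _ hr hs =>
      obtain ⟨M, hM⟩ := hr
      obtain ⟨N, hN⟩ := hs
      refine ⟨M + N, ?_⟩
      rw [smul_add]
      refine add_mem ?_ ?_
      · rw [add_comm, pow_add, mul_smul]
        exact Submodule.smul_mem _ _ hM
      · rw [pow_add, mul_smul]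
        exact Submodule.smul_mem _ _ hN
  obtain ⟨N, hN⟩ := key u (by
    rw [Ideal.smul_top_eq_map]
    exact hu)
  obtain ⟨a, ha, b, hb, hab⟩ := Submodule.mem_sup.1 hN
  have haT : a ∈ T.restrictScalars A := Submodule.smul_le_right ha
  have hbT : b ∈ T.restrictScalars A := by
    rw [← eq_sub_iff_add_eq'] at hab
    rw [hab]
    exact sub_mem ((T.restrictScalars A).smul_mem _ huT) haT
  have hb0 := m.eq_zero_of_mem_restrictSupport_standardExponents hbT (Submodule.smul_le_right hb)
  rw [hb0, add_zero] at hab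
  exact ⟨N, hab ▸ ha⟩

/-- If `h` is a nonzerodivisor modulo `S`, then it is generically a nonzerodivisor modulo `S` on
the fibres over the coefficient ring. -/
theorem exists_generic_nonzerodivisor (m : MonomialOrder σ) [IsDomain A] [Finite σ]
    (S : Ideal (MvPolynomial σ A)) (h : MvPolynomial σ A)
    (hS : ∀ f, h * f ∈ S → f ∈ S) :
    ∃ Δ : A, Δ ≠ 0 ∧ ∀ (𝔪 : Ideal A) (f : MvPolynomial σ A), h * f ∈ S ⊔ 𝔪.map C →
      ∃ N : ℕ, Δ ^ N • f ∈ S ⊔ 𝔪.map C := by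
  obtain ⟨Δ, hΔ0, hΔ⟩ := m.exists_standardReducible_eq_top (S ⊔ Ideal.span {h})
  refine ⟨Δ, hΔ0, fun 𝔪 f hf => ?_⟩
  obtain ⟨s, hs, u, hu, hsu⟩ := Submodule.mem_sup.1 hf
  have huT : u ∈ S ⊔ Ideal.span {h} := by
    rw [← eq_sub_iff_add_eq'] at hsu
    rw [hsu]
    exact sub_mem (Ideal.mem_sup_right (Ideal.mul_mem_right _ _ (Ideal.mem_span_singleton_self h)))
      (Ideal.mem_sup_left hs)
  obtain ⟨N, hN⟩ := m.exists_pow_smul_mem_smul_of_mem hΔ 𝔪 hu huT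
  have split : ∀ v ∈ 𝔪 • (S ⊔ Ideal.span {h}).restrictScalars A,
      ∃ w ∈ 𝔪.map (C : A →+* MvPolynomial σ A), v - h * w ∈ S := by
    intro v hv
    induction hv using Submodule.smul_induction_on' with
    | smul a ha v hv =>
      obtain ⟨s', hs', y, hy, rfl⟩ :=
        Submodule.mem_sup.1 ((Submodule.restrictScalars_mem A _ v).1 hv)
      obtain ⟨w, rfl⟩ := Ideal.mem_span_singleton.1 hy
      refine ⟨C a * w, Ideal.mul_mem_right _ _ (Ideal.mem_map_of_mem _ ha), ?_⟩
      rw [smul_eq_C_mul, show C a * (s' + h * w) - h * (C a * w) = C a * s' by ring]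
      exact S.mul_mem_left _ hs'
    | add v _ v' _ hv hv' =>
      obtain ⟨w, hw, hvw⟩ := hv
      obtain ⟨w', hw', hvw'⟩ := hv'
      refine ⟨w + w', add_mem hw hw', ?_⟩
      rw [show v + v' - h * (w + w') = (v - h * w) + (v' - h * w') by ring]
      exact add_mem hvw hvw'
  obtain ⟨w, hw, hNw⟩ := split _ hN
  refine ⟨N, ?_⟩
  have hmem : Δ ^ N • f - w ∈ S := by
    apply hS
    have heq : h * (Δ ^ N • f - w) = C (Δ ^ N) * s + (Δ ^ N • u - h * w) := by
      rw [smul_eq_C_mul, smul_eq_C_mul]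
      linear_combination -C (Δ ^ N) * hsu
    rw [heq]
    exact add_mem (S.mul_mem_left _ hs) hNw
  rw [← sub_add_cancel (Δ ^ N • f) w]
  exact add_mem (Ideal.mem_sup_left hmem) (Ideal.mem_sup_right hw)

end MonomialOrder

/-- The saturation `I : ⟨h⟩^∞`. -/
def Ideal.saturationBy {R : Type*} [CommRing R] (I : Ideal R) (h : R) : Ideal R where
  carrier := {f | ∃ ℓ : ℕ, 0 < ℓ ∧ f * h ^ ℓ ∈ I}
  zero_mem' := ⟨1, one_pos, by simp⟩
  add_mem' := by
    rintro f g ⟨a, ha, hf⟩ ⟨b, _, hg⟩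
    refine ⟨a + b, by omega, ?_⟩
    rw [show (f + g) * h ^ (a + b) = f * h ^ a * h ^ b + g * h ^ b * h ^ a by ring]
    exact add_mem (I.mul_mem_right _ hf) (I.mul_mem_right _ hg)
  smul_mem' := by
    rintro c f ⟨a, ha, hf⟩
    exact ⟨a, ha, by simpa [mul_assoc] using I.mul_mem_left c hf⟩

theorem Ideal.mem_saturationBy_of_mul_mem {R : Type*} [CommRing R] {I : Ideal R} {h f : R}
    (hf : h * f ∈ I.saturationBy h) : f ∈ I.saturationBy h := by
  obtain ⟨a, _, ha⟩ := hf
  refine ⟨a + 1, a.succ_pos, ?_⟩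
  rwa [show f * h ^ (a + 1) = h * f * h ^ a by ring]

theorem Ideal.le_saturationBy {R : Type*} [CommRing R] (I : Ideal R) (h : R) :
    I ≤ I.saturationBy h :=
  fun _ hf => ⟨1, one_pos, I.mul_mem_right _ hf⟩

theorem MvPolynomial.map_eval_sumRingEquiv {σ τ R : Type*} [CommRing R] (q : τ → R)
    (f : MvPolynomial (σ ⊕ τ) R) :
    map (eval q) (sumRingEquiv R σ τ f) = aeval (Sum.elim X fun j => C (q j)) f := by
  induction f using MvPolynomial.induction_on with
  | C a => simp [algebraMap_eq]
  | add f g hf hg => simp [hf, hg]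
  | mul_X f i hf => cases i <;> simp [hf]

/-- Let `I ⊆ ℂ[x,p]` be an ideal and `J = ⟨h⟩` a principal ideal with
`(I : J^∞) ∩ ℂ[p] = {0}`. Then there is a proper algebraic subvariety `Δ ⊊ ℂ^k` (the zero
set of a nonzero polynomial in `ℂ[p]`) such that for all `q ∉ Δ`,
`φ_q(I : J^∞) = φ_q(I) : φ_q(J)^∞`. -/
theorem image_saturation_eq_saturation_image_generically
    {n k : ℕ} (I : Ideal (MvPolynomial (Fin n ⊕ Fin k) ℂ))
    (h : MvPolynomial (Fin n ⊕ Fin k) ℂ)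
    (hsat : ∀ g : MvPolynomial (Fin k) ℂ,
      (rename Sum.inr g ∈ {f | ∃ ℓ : ℕ, 0 < ℓ ∧ f * h ^ ℓ ∈ I}) → g = 0) :
    ∃ Δ : MvPolynomial (Fin k) ℂ, Δ ≠ 0 ∧
      ∀ q : Fin k → ℂ, eval q Δ ≠ 0 →
        (aeval (Sum.elim X (fun j => C (q j))) :
            MvPolynomial (Fin n ⊕ Fin k) ℂ →ₐ[ℂ] MvPolynomial (Fin n) ℂ) ''
            {f | ∃ ℓ : ℕ, 0 < ℓ ∧ f * h ^ ℓ ∈ I} =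
          {f | ∃ ℓ : ℕ, 0 < ℓ ∧
            f * (aeval (Sum.elim X (fun j => C (q j))) h) ^ ℓ ∈
              Ideal.map (aeval (Sum.elim X (fun j => C (q j))) :
                MvPolynomial (Fin n ⊕ Fin k) ℂ →ₐ[ℂ] MvPolynomial (Fin n) ℂ).toRingHom I} := by
  obtain ⟨Δ, hΔ0, hΔ⟩ := (MonomialOrder.lex (σ := Fin n)).exists_generic_nonzerodivisor
    ((I.saturationBy h).comap (sumRingEquiv ℂ (Fin n) (Fin k)).symm.toRingHom)
    (sumRingEquiv ℂ (Fin n) (Fin k) h)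
    (fun f hf => Ideal.mem_saturationBy_of_mul_mem (by simpa [Ideal.mem_comap] using hf))
  refine ⟨Δ, hΔ0, fun q hq => ?_⟩
  set φ : MvPolynomial (Fin n ⊕ Fin k) ℂ →ₐ[ℂ] MvPolynomial (Fin n) ℂ :=
    aeval (Sum.elim X (fun j => C (q j))) with hφ
  have hφinl : ∀ g : MvPolynomial (Fin n) ℂ, φ (rename Sum.inl g) = g := fun g => by
    rw [hφ, aeval_rename, Sum.elim_comp_inl, aeval_X_left_apply]
  have hφsurj : Function.Surjective φ := fun g => ⟨_, hφinl g⟩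
  set S := (I.saturationBy h).comap (sumRingEquiv ℂ (Fin n) (Fin k)).symm.toRingHom with hS
  have hmem : ∀ f : MvPolynomial (Fin n) (MvPolynomial (Fin k) ℂ),
      f ∈ S ⊔ (RingHom.ker (eval q)).map C ↔
        ∃ s ∈ I.saturationBy h, φ s = map (eval q) f := by
    intro f
    rw [← ker_map]
    constructor
    · intro hf
      obtain ⟨s, hs, u, hu, rfl⟩ := Submodule.mem_sup.1 hf
      refine ⟨_, hs, ?_⟩
      rw [hφ, ← map_eval_sumRingEquiv, map_add, (RingHom.mem_ker).1 hu]
      simp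
    · rintro ⟨s, hs, hsf⟩
      rw [← add_sub_cancel (sumRingEquiv ℂ (Fin n) (Fin k) s) f]
      refine add_mem (Ideal.mem_sup_left ?_) (Ideal.mem_sup_right ?_)
      · simpa [hS, Ideal.mem_comap] using hs
      · rw [RingHom.mem_ker, map_sub, map_eval_sumRingEquiv, ← hφ, hsf, sub_self]
  have hcancel : ∀ g : MvPolynomial (Fin n) ℂ, (∃ s ∈ I.saturationBy h, φ s = φ h * g) →
      ∃ s ∈ I.saturationBy h, φ s = g := by
    rintro g ⟨s, hs, hsg⟩
    obtain ⟨N, hN⟩ := hΔ (RingHom.ker (eval q))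
      (sumRingEquiv ℂ (Fin n) (Fin k) (rename Sum.inl g))
      ((hmem _).2 ⟨s, hs, by
        rw [← map_mul, map_eval_sumRingEquiv, ← hφ, map_mul, hφinl, hsg]⟩)
    obtain ⟨s', hs', hsg'⟩ := (hmem _).1 hN
    refine ⟨C ((eval q Δ ^ N)⁻¹) * s', Ideal.mul_mem_left _ _ hs', ?_⟩
    rw [smul_eq_C_mul, map_mul, map_eval_sumRingEquiv, ← hφ, hφinl, map_C, map_pow] at hsg'
    rw [map_mul, hsg', hφ, aeval_C, algebraMap_eq, ← mul_assoc, ← C_mul,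
      inv_mul_cancel₀ (pow_ne_zero _ hq), C_1, one_mul]
  ext g
  constructor
  · rintro ⟨f, ⟨ℓ, hℓ, hf⟩, rfl⟩
    refine ⟨ℓ, hℓ, ?_⟩
    rw [← map_pow, ← map_mul]
    exact Ideal.mem_map_of_mem φ.toRingHom hf
  · rintro ⟨ℓ, -, hg⟩
    have hpow : ∃ s ∈ I.saturationBy h, φ s = φ h ^ ℓ * g := by
      obtain ⟨s, hs, hsg⟩ := (Ideal.mem_map_iff_of_surjective φ.toRingHom hφsurj).1 hg
      exact ⟨s, I.le_saturationBy h hs, hsg.trans (mul_comm _ _)⟩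
    clear hg
    induction ℓ with
    | zero =>
      rw [pow_zero, one_mul] at hpow
      exact hpow
    | succ ℓ ih => exact ih (hcancel _ (by simpa only [pow_succ', mul_assoc] using hpow))
end

section
/- (Parameter Continuation Theorem) Let F(x;p) be a family of n polynomials in n variables x with k complex parameters p, and for q ∈ ℂ^k let N(q) be the number of regular zeros of F(x;q). Then N := sup_q N(q) is finite, and there exists a proper algebraic subvariety Δ ⊊ ℂ^k such that N(q) = N for all q ∉ Δ. -/
open MvPolynomial

open TensorProduct Filter Topology

/-- The locus of `R[x₁, …, xₙ] ⧸ (v₁, …, vₙ)` where the Jacobian determinant is invertible is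
étale over `R`. -/
theorem Algebra.Etale.of_away_jacobian {R : Type*} [CommRing R] {n : ℕ} (v : Fin n → MvPolynomial (Fin n) R)
    (S : Type*) [CommRing S] [Algebra (MvPolynomial (Fin n) R ⧸ Ideal.span (Set.range v)) S]
    [Algebra R S] [IsScalarTower R (MvPolynomial (Fin n) R ⧸ Ideal.span (Set.range v)) S]
    [IsLocalization.Away (Ideal.Quotient.mk (Ideal.span (Set.range v))
      (Matrix.det (Matrix.of fun i j => pderiv j (v i)))) S] : Algebra.Etale R S := by
  let J := Ideal.Quotient.mk (Ideal.span (Set.range v))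
    (Matrix.det (Matrix.of fun i j => pderiv j (v i)))
  let P : Algebra.PreSubmersivePresentation R (MvPolynomial (Fin n) R ⧸ Ideal.span (Set.range v))
    (Fin n) (Fin n) :=
      .naive (v := v) _root_.id Function.injective_id
  have hP : P.jacobian = J := by
    have h : aeval P.val = Ideal.Quotient.mkₐ R (Ideal.span (Set.range v)) := by
      ext i
      simp [P, Algebra.PreSubmersivePresentation.naive, Algebra.Presentation.naive,
        Algebra.Generators.naive]
    rw [P.jacobian_eq_jacobiMatrix_det, ← Matrix.det_transpose,
      Algebra.Generators.algebraMap_apply, h]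
    refine congrArg (fun M => Ideal.Quotient.mk _ (Matrix.det M)) (Matrix.ext fun i j => ?_)
    exact P.jacobiMatrix_apply j i
  let Q : Algebra.PreSubmersivePresentation _ S Unit Unit := .localizationAway S J
  have hu : IsUnit (algebraMap _ S J) := IsLocalization.Away.algebraMap_isUnit _
  let T : Algebra.SubmersivePresentation R S (Unit ⊕ Fin n) (Unit ⊕ Fin n) :=
    { __ := Q.comp P
      jacobian_isUnit := by
        have : (Q.comp P).jacobian = P.jacobian • Q.jacobian :=
          Algebra.PreSubmersivePresentation.comp_jacobian_eq_jacobian_smul_jacobian Q P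
        rw [this, Algebra.PreSubmersivePresentation.localizationAway_jacobian, hP,
          Algebra.smul_def]
        exact hu.mul hu }
  have : Algebra.IsStandardSmoothOfRelativeDimension 0 R S :=
    T.isStandardSmoothOfRelativeDimension (by simp [Algebra.Presentation.dimension])
  infer_instance

/-- The `T`-points of the locus of `R[x₁, …, xₙ] ⧸ (v₁, …, vₙ)` where the Jacobian determinant is
invertible are the zeros of `v` in `T` at which the Jacobian determinant is invertible. -/
theorem nonempty_algHom_away_jacobian_equiv {R : Type*} [CommRing R] {n : ℕ} (v : Fin n → MvPolynomial (Fin n) R)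
    (S : Type*) [CommRing S] [Algebra (MvPolynomial (Fin n) R ⧸ Ideal.span (Set.range v)) S]
    [Algebra R S] [IsScalarTower R (MvPolynomial (Fin n) R ⧸ Ideal.span (Set.range v)) S]
    [IsLocalization.Away (Ideal.Quotient.mk (Ideal.span (Set.range v))
      (Matrix.det (Matrix.of fun i j => pderiv j (v i)))) S]
    (T : Type*) [CommRing T] [Algebra R T] :
    Nonempty ((S →ₐ[R] T) ≃ {x : Fin n → T | (∀ i, aeval x (v i) = 0) ∧
      IsUnit (aeval x (Matrix.det (Matrix.of fun i j => pderiv j (v i))))}) := by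
  let J := Matrix.det (Matrix.of fun i j => pderiv j (v i))
  let mk := Ideal.Quotient.mk (Ideal.span (Set.range v))
  let π : MvPolynomial (Fin n) R →ₐ[R] S :=
    (IsScalarTower.toAlgHom R (MvPolynomial (Fin n) R ⧸ Ideal.span (Set.range v)) S).comp
      (Ideal.Quotient.mkₐ R _)
  have hπ (φ : S →ₐ[R] T) (p) : aeval (fun i => φ (π (X i))) p = φ (π p) := by
    have : aeval (fun i => φ (π (X i))) = φ.comp π := by ext; simp
    rw [this]; rfl
  have hv (i) : π (v i) = 0 := by
    have : mk (v i) = 0 := Ideal.Quotient.eq_zero_iff_mem.mpr (Ideal.subset_span ⟨i, rfl⟩)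
    simpa only [map_zero] using! congrArg (algebraMap _ S) this
  have hJ : IsUnit (π J) := IsLocalization.Away.algebraMap_isUnit (mk J)
  let ev (φ : S →ₐ[R] T) : {x : Fin n → T | (∀ i, aeval x (v i) = 0) ∧ IsUnit (aeval x J)} :=
    ⟨fun i => φ (π (X i)), fun i => by rw [hπ, hv, map_zero], by rw [hπ]; exact hJ.map φ⟩
  refine ⟨Equiv.ofBijective ev ⟨fun φ ψ h => ?_, fun ⟨x, hx, hu⟩ => ?_⟩⟩
  · apply IsLocalization.algHom_ext (Submonoid.powers (mk J))
    apply Ideal.Quotient.algHom_ext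
    ext i
    exact congrFun (congrArg Subtype.val h) i
  · have hker : Ideal.span (Set.range v) ≤ RingHom.ker (aeval (R := R) x) :=
      Ideal.span_le.mpr (by rintro _ ⟨i, rfl⟩; exact hx i)
    let φ₀ : (MvPolynomial (Fin n) R ⧸ Ideal.span (Set.range v)) →ₐ[R] T :=
      Ideal.Quotient.liftₐ _ (aeval x) fun a ha => hker ha
    have hφ₀ (y : Submonoid.powers (mk J)) : IsUnit (φ₀ y) := by
      obtain ⟨_, m, rfl⟩ := y
      rw [map_pow]
      exact hu.pow m
    refine ⟨IsLocalization.liftAlgHom (M := Submonoid.powers (mk J)) (f := φ₀) hφ₀,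
      Subtype.ext (funext fun i => ?_)⟩
    refine (IsLocalization.lift_eq (M := Submonoid.powers (mk J)) hφ₀ (mk (X i))).trans ?_
    exact aeval_X x i

/-- Over a separably closed field, an étale algebra has as many points as its dimension. -/
theorem Algebra.Etale.card_algHom_eq_finrank (K A : Type*) [Field K] [IsSepClosed K]
    [CommRing A] [Algebra K A] [Algebra.Etale K A] :
    Finite (A →ₐ[K] K) ∧ Nat.card (A →ₐ[K] K) = Module.finrank K A := by
  have := Algebra.FormallyUnramified.finite_of_free K A
  have : IsArtinianRing A := isArtinian_of_tower K inferInstance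
  have := Fintype.ofFinite (PrimeSpectrum A)
  have e := Algebra.IsFiniteSplit.algHomEquivPrimeSpectrum K A
  refine ⟨.of_equiv _ e.symm, ?_⟩
  rw [Nat.card_congr e,
    (Algebra.FormallyEtale.equivPiOfIsSepClosed K A).toLinearEquiv.finrank_eq,
    Module.finrank_fintype_fun_eq_card, Nat.card_eq_fintype_card]

/-- An étale algebra over a domain becomes finite after inverting a nonzero element. -/
theorem Algebra.Etale.exists_finite_away (R A : Type*) [CommRing R] [IsDomain R] [CommRing A]
    [Algebra R A] [Algebra.Etale R A] :
    ∃ g : R, g ≠ 0 ∧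
      Module.Finite (Localization.Away g) (Localization.Away g ⊗[R] A) := by
  have hfin : Module.Finite (FractionRing R) (FractionRing R ⊗[R] A) :=
    Algebra.FormallyUnramified.finite_of_free _ _
  have hinj : Function.Injective (Algebra.TensorProduct.includeRight :
      A →ₐ[R] FractionRing R ⊗[R] A) :=
    Algebra.TensorProduct.includeRight_injective (IsFractionRing.injective R (FractionRing R))
  have halg (a : A) : IsAlgebraic R a := by
    rw [← isAlgebraic_algHom_iff _ hinj, IsFractionRing.isAlgebraic_iff R (FractionRing R)]
    exact Algebra.IsAlgebraic.isAlgebraic _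
  obtain ⟨s, hs⟩ := (inferInstance : Algebra.FiniteType R A).out
  choose r hr hint using fun a => (halg a).exists_integral_multiple
  refine ⟨∏ a ∈ s, r a, Finset.prod_ne_zero_iff.mpr fun a _ => hr a, ?_⟩
  set g := ∏ a ∈ s, r a
  have hu (a) (ha : a ∈ s) : IsUnit (algebraMap R (Localization.Away g) (r a)) :=
    isUnit_of_dvd_unit (map_dvd _ (Finset.dvd_prod_of_mem r ha))
      (IsLocalization.Away.algebraMap_isUnit g)
  have : Algebra.IsIntegral (Localization.Away g) (Localization.Away g ⊗[R] A) := by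
    have key (a : A) : IsIntegral (Localization.Away g)
        (Algebra.TensorProduct.includeRight a : Localization.Away g ⊗[R] A) := by
      have ha : a ∈ Algebra.adjoin R (s : Set A) := hs ▸ Algebra.mem_top
      induction ha using Algebra.adjoin_induction with
      | mem a ha =>
        have h1 : IsIntegral (Localization.Away g)
            (Algebra.TensorProduct.includeRight (r a • a) : Localization.Away g ⊗[R] A) :=
          ((hint a).map (Algebra.TensorProduct.includeRight :
            A →ₐ[R] Localization.Away g ⊗[R] A)).tower_top
        obtain ⟨u, hu⟩ := hu a ha
        have h2 := h1.smul (↑u⁻¹ : Localization.Away g)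
        rwa [map_smul, ← algebraMap_smul (Localization.Away g) (r a), ← hu, smul_smul, Units.inv_mul,
          one_smul] at h2
      | algebraMap x =>
        rw [AlgHom.commutes, IsScalarTower.algebraMap_apply R (Localization.Away g)]
        exact isIntegral_algebraMap
      | add x y _ _ hx hy => rw [map_add]; exact hx.add hy
      | mul x y _ _ hx hy => rw [map_mul]; exact hx.mul hy
    refine ⟨fun x => ?_⟩
    induction x with
    | zero => exact isIntegral_zero
    | add x y hx hy => exact hx.add hy
    | tmul x a =>
      have : x ⊗ₜ[R] a = x • (Algebra.TensorProduct.includeRight a : Localization.Away g ⊗[R] A) := by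
        simp [TensorProduct.smul_tmul']
      rw [this]
      exact (key a).smul x
  exact Algebra.IsIntegral.finite

/-- Generic constancy of the fibre dimension of an étale algebra over a domain. -/
theorem Algebra.Etale.exists_finrank_eq (R A : Type*) [CommRing R] [IsDomain R] [CommRing A]
    [Algebra R A] [Algebra.Etale R A] (K : Type*) [Field K] :
    ∃ (g : R) (d : ℕ), g ≠ 0 ∧ ∀ [Algebra R K], algebraMap R K g ≠ 0 →
      Module.finrank K (K ⊗[R] A) = d := by
  obtain ⟨g, hg, hfin⟩ := Algebra.Etale.exists_finite_away R A
  have : IsDomain (Localization.Away g) :=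
    IsLocalization.isDomain_localization (powers_le_nonZeroDivisors_of_noZeroDivisors hg)
  refine ⟨g, Module.rankAtStalk (R := Localization.Away g) (Localization.Away g ⊗[R] A)
    ⟨⊥, Ideal.isPrime_bot⟩, hg, fun {_} hgK => ?_⟩
  let φ : Localization.Away g →ₐ[R] K :=
    IsLocalization.liftAlgHom (M := Submonoid.powers g) (f := Algebra.ofId R K) (by
      rintro ⟨_, m, rfl⟩
      simpa [Algebra.ofId_apply] using fun h => absurd h hgK)
  algebraize [φ.toRingHom]
  have : IsScalarTower R (Localization.Away g) K := .of_algebraMap_eq' φ.comp_algebraMap.symm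
  rw [← (AlgebraTensorModule.cancelBaseChange R (Localization.Away g) K K A).finrank_eq]
  have h := Module.rankAtStalk_baseChange (R := Localization.Away g) (S := K)
    (M := Localization.Away g ⊗[R] A) ⟨⊥, Ideal.isPrime_bot⟩
  rw [Module.rankAtStalk_eq_finrank_of_free] at h
  rw [Module.rankAtStalk_eq_of_le_of_finite_of_flat _ (p := ⟨⊥, Ideal.isPrime_bot⟩)]
  · exact h
  · exact bot_le (α := Ideal (Localization.Away g))

theorem MvPolynomial.hasStrictFDerivAt_eval {σ : Type*} [Fintype σ] {𝕜 : Type*}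
    [NontriviallyNormedField 𝕜] (p : MvPolynomial σ 𝕜) (v : σ → 𝕜) :
    HasStrictFDerivAt (fun w => eval w p)
      (∑ i, eval v (pderiv i p) • ContinuousLinearMap.proj (R := 𝕜) (φ := fun _ : σ => 𝕜) i) v := by
  classical
  induction p using MvPolynomial.induction_on with
  | C a =>
    simp only [eval_C]
    refine (hasStrictFDerivAt_const (𝕜 := 𝕜) a v).congr_fderiv ?_
    ext w
    simp
  | add p q hp hq =>
    simp only [map_add]
    refine (hp.add hq).congr_fderiv ?_
    ext w
    simp [add_mul, Finset.sum_add_distrib]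
  | mul_X p i hp =>
    have hX : HasStrictFDerivAt (fun w : σ → 𝕜 => w i)
      (ContinuousLinearMap.proj (R := 𝕜) (φ := fun _ : σ => 𝕜) i) v :=
      (ContinuousLinearMap.proj (R := 𝕜) (φ := fun _ : σ => 𝕜) i).hasStrictFDerivAt
    have h := hp.mul hX
    simp only [map_mul, eval_X]
    refine h.congr_fderiv ?_
    ext w
    simp [pderiv_X, Pi.single_apply, add_mul, Finset.sum_add_distrib, Finset.mul_sum, mul_assoc, apply_ite]

theorem MvPolynomial.frequently_eval_ne_zero {k : ℕ} {g : MvPolynomial (Fin k) ℂ} (hg : g ≠ 0)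
    (q : Fin k → ℂ) : ∃ᶠ p in 𝓝 q, eval p g ≠ 0 := by
  intro h
  simp only [not_not] at h
  obtain ⟨ε, hε, hball⟩ := Metric.eventually_nhds_iff.mp h
  refine hg (MvPolynomial.funext_set (fun i => Metric.ball (q i) ε)
    (fun i => ?_) fun x hx => ?_)
  · exact infinite_of_mem_nhds (q i) (Metric.ball_mem_nhds _ hε)
  · rw [map_zero]
    exact hball ((dist_pi_lt_iff hε).mpr fun i => hx i trivial)

theorem exists_continuation_of_regular_zero {n k : ℕ} (f : Fin n → MvPolynomial (Fin n ⊕ Fin k) ℂ)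
    (q : Fin k → ℂ) (x : Fin n → ℂ) (hx : ∀ i, eval (Sum.elim x q) (f i) = 0)
    (hdet : Matrix.det (Matrix.of fun i j =>
      eval (Sum.elim x q) (pderiv (Sum.inl j) (f i))) ≠ 0) :
    ∃ φ : (Fin k → ℂ) → (Fin n → ℂ), Tendsto φ (𝓝 q) (𝓝 x) ∧
      ∀ᶠ p in 𝓝 q, (∀ i, eval (Sum.elim (φ p) p) (f i) = 0) ∧
        Matrix.det (Matrix.of fun i j =>
          eval (Sum.elim (φ p) p) (pderiv (Sum.inl j) (f i))) ≠ 0 := by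
  let L : ((Fin k → ℂ) × (Fin n → ℂ)) →L[ℂ] (Fin n ⊕ Fin k → ℂ) :=
    ContinuousLinearMap.pi (Sum.elim
      (fun j => (ContinuousLinearMap.proj j).comp (ContinuousLinearMap.snd ℂ _ _))
      (fun j => (ContinuousLinearMap.proj j).comp (ContinuousLinearMap.fst ℂ _ _)))
  have hL (u) : L u = Sum.elim u.2 u.1 := by
    ext (j | j) <;> rfl
  let D : ((Fin k → ℂ) × (Fin n → ℂ)) →L[ℂ] (Fin n → ℂ) :=
    ContinuousLinearMap.pi fun i => (∑ j, eval (Sum.elim x q) (pderiv j (f i)) •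
      ContinuousLinearMap.proj (R := ℂ) (φ := fun _ : Fin n ⊕ Fin k => ℂ) j).comp L
  have hD : HasStrictFDerivAt (fun u : (Fin k → ℂ) × (Fin n → ℂ) =>
      fun i => eval (Sum.elim u.2 u.1) (f i)) D (q, x) := by
    rw [hasStrictFDerivAt_pi']
    intro i
    simp_rw [← hL]
    have := (f i).hasStrictFDerivAt_eval (L (q, x))
    have := this.comp (q, x) L.hasStrictFDerivAt
    rw [hL] at this
    exact this
  have hinv : (D ∘L ContinuousLinearMap.inr ℂ (Fin k → ℂ) (Fin n → ℂ)).IsInvertible := by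
    set J : Matrix (Fin n) (Fin n) ℂ := Matrix.of fun i j =>
      eval (Sum.elim x q) (pderiv (Sum.inl j) (f i))
    let e : (Fin n → ℂ) ≃ₗ[ℂ] (Fin n → ℂ) :=
      Matrix.toLinearEquiv' J (J.invertibleOfIsUnitDet (isUnit_iff_ne_zero.mpr hdet))
    refine ⟨e.toContinuousLinearEquiv, ?_⟩
    ext y i
    change J.mulVec y i = _
    simp [D, L, J, Matrix.mulVec, dotProduct]
  have ht := hD.tendsto_implicitFunctionOfProdDomain hinv
  have he := hD.eventually_apply_implicitFunctionOfProdDomain hinv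
  refine ⟨hD.implicitFunctionOfProdDomain hinv, ht, ?_⟩
  have hc : Continuous fun u : (Fin k → ℂ) × (Fin n → ℂ) => Matrix.det (Matrix.of fun i j =>
      eval (Sum.elim u.2 u.1) (pderiv (Sum.inl j) (f i))) := by
    refine Continuous.matrix_det (continuous_matrix fun i j => ?_)
    simp_rw [← hL]
    exact (MvPolynomial.continuous_eval _).comp L.continuous
  have hne := (tendsto_id.prodMk_nhds ht).eventually (hc.continuousAt.eventually_ne hdet)
  filter_upwards [he, hne] with p h1 h2
  exact ⟨fun i => (congrFun h1 i).trans (hx i), h2⟩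

theorem MvPolynomial.aeval_sumAlgEquiv {σ τ K : Type*} [Field K]
    (q : τ → K) [Algebra (MvPolynomial τ K) K]
    (hq : algebraMap (MvPolynomial τ K) K = eval q) (x : σ → K) (p : MvPolynomial (σ ⊕ τ) K) :
    aeval x (sumAlgEquiv K σ τ p) = eval (Sum.elim x q) p := by
  induction p using MvPolynomial.induction_on with
  | C a => simp [hq]
  | add p r hp hr => simp [hp, hr]
  | mul_X p i hp => cases i <;> simp [hp, hq]

/-- The set of regular zeros of `F(x;q)`. -/
def regularZeros {n k : ℕ} (f : Fin n → MvPolynomial (Fin n ⊕ Fin k) ℂ) (q : Fin k → ℂ) :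
    Set (Fin n → ℂ) :=
  {x | (∀ i, eval (Sum.elim x q) (f i) = 0) ∧
    Matrix.det (Matrix.of fun i j => eval (Sum.elim x q) (pderiv (Sum.inl j) (f i))) ≠ 0}

theorem exists_ncard_regularZeros_eq {n k : ℕ} (f : Fin n → MvPolynomial (Fin n ⊕ Fin k) ℂ) :
    ∃ (g : MvPolynomial (Fin k) ℂ) (d : ℕ), g ≠ 0 ∧
      ∀ q, eval q g ≠ 0 → (regularZeros f q).Finite ∧ (regularZeros f q).ncard = d := by
  let v (i : Fin n) : MvPolynomial (Fin n) (MvPolynomial (Fin k) ℂ) :=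
    sumAlgEquiv ℂ (Fin n) (Fin k) (f i)
  let S := Localization.Away (Ideal.Quotient.mk (Ideal.span (Set.range v))
      (Matrix.det (Matrix.of fun i j => pderiv j (v i))))
  have : Algebra.Etale (MvPolynomial (Fin k) ℂ) S := .of_away_jacobian v S
  obtain ⟨g, d, hg, hd⟩ := Algebra.Etale.exists_finrank_eq (MvPolynomial (Fin k) ℂ) S ℂ
  refine ⟨g, d, hg, fun q hq => ?_⟩
  let _ : Algebra (MvPolynomial (Fin k) ℂ) ℂ := (eval q).toAlgebra
  have halg : algebraMap (MvPolynomial (Fin k) ℂ) ℂ = eval q := rfl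
  obtain ⟨e⟩ := nonempty_algHom_away_jacobian_equiv v S ℂ
  have hset : {x : Fin n → ℂ | (∀ i, aeval x (v i) = 0) ∧
      IsUnit (aeval x (Matrix.det (Matrix.of fun i j => pderiv j (v i))))} = regularZeros f q := by
    ext x
    simp only [v, regularZeros, Set.mem_ofPred_eq, aeval_sumAlgEquiv q halg, isUnit_iff_ne_zero,
      AlgHom.map_det]
    congr! 4
    ext i j
    simp [pderiv_sumAlgEquiv, aeval_sumAlgEquiv q halg]
  rw [hset] at e
  let e' := (AlgHom.liftEquiv (MvPolynomial (Fin k) ℂ) ℂ S ℂ).symm.trans e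
  obtain ⟨hfin, hcard⟩ := Algebra.Etale.card_algHom_eq_finrank ℂ (ℂ ⊗[MvPolynomial (Fin k) ℂ] S)
  refine ⟨Set.finite_coe_iff.mp (.of_equiv _ e'), ?_⟩
  rw [← Nat.card_coe_set_eq, ← Nat.card_congr e', hcard]
  exact hd hq

theorem eventually_exists_card_le_regularZeros {n k : ℕ}
    (f : Fin n → MvPolynomial (Fin n ⊕ Fin k) ℂ) (q : Fin k → ℂ) (s : Finset (Fin n → ℂ))
    (hs : ↑s ⊆ regularZeros f q) :
    ∀ᶠ p in 𝓝 q, ∃ t : Finset (Fin n → ℂ), ↑t ⊆ regularZeros f p ∧ t.card = s.card := by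
  classical
  choose! φ hφ hzero using fun x (hx : x ∈ s) =>
    exists_continuation_of_regular_zero f q x (hs hx).1 (hs hx).2
  have hinj : ∀ᶠ p in 𝓝 q, ∀ x ∈ s, ∀ y ∈ s, x ≠ y → φ x p ≠ φ y p := by
    simp only [Finset.eventually_all, eventually_imp_distrib_left]
    exact fun x hx y hy hxy =>
      (((hφ x hx).sub (hφ y hy)).eventually_ne (sub_ne_zero.mpr hxy)).mono fun p => sub_ne_zero.mp
  have hzeros : ∀ᶠ p in 𝓝 q, ∀ x ∈ s, φ x p ∈ regularZeros f p :=
    (Finset.eventually_all s).mpr hzero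
  filter_upwards [hinj, hzeros] with p hinj hzeros
  refine ⟨s.image (φ · p), ?_, Finset.card_image_of_injOn fun x hx y hy h => ?_⟩
  · simpa [Set.subset_def] using hzeros
  · by_contra hxy
    exact hinj x hx y hy hxy h

/-- **The Parameter Continuation Theorem.** Let `F(x;p)` be a family of `n` polynomials in
`n` variables `x` with `k` complex parameters `p`, and for `q ∈ ℂ^k` let `N(q)` be the number
of regular zeros of `F(x;q)`. Then `N := sup_q N(q)` is finite (every `N(q)` is finite and
bounded by `N`), and there exists a proper algebraic subvariety `Δ ⊊ ℂ^k` (the zero set of a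
nonzero ideal of `ℂ[p]`) such that `N(q) = N` for all `q ∉ Δ`. -/
theorem parameter_continuation {n k : ℕ}
    (f : Fin n → MvPolynomial (Fin n ⊕ Fin k) ℂ) :
    ∃ (N : ℕ) (Δ : Ideal (MvPolynomial (Fin k) ℂ)), Δ ≠ ⊥ ∧
      (∀ q : Fin k → ℂ,
        {x : Fin n → ℂ | (∀ i, eval (Sum.elim x q) (f i) = 0) ∧
          Matrix.det (Matrix.of fun i j => eval (Sum.elim x q) (pderiv (Sum.inl j) (f i))) ≠ 0}.Finite ∧
        {x : Fin n → ℂ | (∀ i, eval (Sum.elim x q) (f i) = 0) ∧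
          Matrix.det (Matrix.of fun i j => eval (Sum.elim x q) (pderiv (Sum.inl j) (f i))) ≠ 0}.ncard ≤ N) ∧
      (∀ q : Fin k → ℂ, (∃ g ∈ Δ, eval q g ≠ 0) →
        {x : Fin n → ℂ | (∀ i, eval (Sum.elim x q) (f i) = 0) ∧
          Matrix.det (Matrix.of fun i j => eval (Sum.elim x q) (pderiv (Sum.inl j) (f i))) ≠ 0}.ncard = N) := by
  obtain ⟨g, d, hg, hd⟩ := exists_ncard_regularZeros_eq f
  have hle (q : Fin k → ℂ) (s : Finset (Fin n → ℂ)) (hs : ↑s ⊆ regularZeros f q) : s.card ≤ d := by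
    obtain ⟨p, hp, t, ht, hcard⟩ := ((frequently_eval_ne_zero hg q).and_eventually
      (eventually_exists_card_le_regularZeros f q s hs)).exists
    obtain ⟨hfin, hncard⟩ := hd p hp
    rw [← hcard, ← hncard, ← Set.ncard_coe_finset]
    exact Set.ncard_le_ncard ht hfin
  refine ⟨d, Ideal.span {g}, by simpa using hg, fun q => ?_, ?_⟩
  · have hfin : (regularZeros f q).Finite := by
      by_contra hinf
      obtain ⟨t, ht, hcard⟩ := Set.Infinite.exists_subset_card_eq hinf (d + 1)
      have := hle q t ht
      omega
    refine ⟨hfin, (Set.ncard_eq_toFinset_card _ hfin).trans_le (hle q _ ?_)⟩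
    simp
  · rintro q ⟨_, hmem, hne⟩
    obtain ⟨h, rfl⟩ := Ideal.mem_span_singleton.mp hmem
    exact (hd q fun h0 => hne (by simp [h0])).2
end
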